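/- arXiv:1812.02086 — 6 statements merged into one kernel-verified Lean document; each statement's English description precedes it below -/
import Mathlib

section
/- Let Y be a CAT(0) metric space, x ∈ Y, and let γ, η : [0,1] → Y be geodesics with γ 0 = η 0 = x and η nonconstant. Then the limit L₁ := lim_{t→0⁺} (d(γ t, η 1) − d(x, η 1))/t exists, the joint limit L₂ := lim_{t,s→0⁺} (d(x, γ t)² + d(x, η s)² − d(γ t, η s)²)/(2·t·s) exists, and L₂ = −d(x, η 1)·L₁ (first variation formula). -/
open Filter

/-- A (constant-speed) geodesic defined on `[0,1]` in a metric space. -/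
def IsGeodesic {Y : Type*} [MetricSpace Y] (γ : ℝ → Y) : Prop :=
  ∀ s ∈ Set.Icc (0:ℝ) 1, ∀ t ∈ Set.Icc (0:ℝ) 1,
    dist (γ s) (γ t) = |s - t| * dist (γ 0) (γ 1)

/-- A metric space is CAT(0) if it is geodesic and every geodesic satisfies the
CAT(0) comparison inequality. -/
def IsCatZero (Y : Type*) [MetricSpace Y] : Prop :=
  (∀ x y : Y, ∃ γ : ℝ → Y, IsGeodesic γ ∧ γ 0 = x ∧ γ 1 = y) ∧
  (∀ γ : ℝ → Y, IsGeodesic γ → ∀ z : Y, ∀ t ∈ Set.Icc (0:ℝ) 1,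
    dist (γ t) z ^ 2 ≤ (1 - t) * dist (γ 0) z ^ 2 + t * dist (γ 1) z ^ 2
      - t * (1 - t) * dist (γ 0) (γ 1) ^ 2)

theorem IsGeodesic.comp_mul {Y : Type*} [MetricSpace Y] {γ : ℝ → Y} (hγ : IsGeodesic γ)
    {r : ℝ} (hr : r ∈ Set.Icc (0:ℝ) 1) : IsGeodesic fun t => γ (r * t) := by
  obtain ⟨hr0, hr1⟩ := hr
  rintro s ⟨hs0, hs1⟩ t ⟨ht0, ht1⟩
  have h1 := hγ (r * s) ⟨by positivity, by nlinarith⟩ (r * t) ⟨by positivity, by nlinarith⟩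
  have h2 := hγ (r * 0) ⟨by simp, by simp⟩ (r * 1) ⟨by simpa, by simpa⟩
  change dist (γ (r * s)) (γ (r * t)) = |s - t| * dist (γ (r * 0)) (γ (r * 1))
  rw [h1, h2, ← mul_sub, ← mul_sub, abs_mul, abs_mul, zero_sub, abs_neg, abs_one]
  ring

theorem IsGeodesic.dist_zero {Y : Type*} [MetricSpace Y] {γ : ℝ → Y} (hγ : IsGeodesic γ)
    {t : ℝ} (ht : t ∈ Set.Icc (0:ℝ) 1) : dist (γ 0) (γ t) = t * dist (γ 0) (γ 1) := by
  rw [hγ 0 ⟨le_rfl, zero_le_one⟩ t ht, zero_sub, abs_neg, abs_of_nonneg ht.1]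

/-- The quotient `(d(γ 0, γ t)² + d(γ 0, z)² - d(γ t, z)²) / (2t)`, which for `t > 0` is
`d(γ 0, γ 1) · d(γ 0, z)` times the cosine of the comparison angle at `γ 0`. -/
noncomputable def comparisonQuotient {Y : Type*} [MetricSpace Y] (γ : ℝ → Y) (z : Y) (t : ℝ) : ℝ :=
  (dist (γ 0) (γ t) ^ 2 + dist (γ 0) z ^ 2 - dist (γ t) z ^ 2) / (2 * t)

theorem comparisonQuotient_antitoneOn {Y : Type*} [MetricSpace Y] (hY : IsCatZero Y) {γ : ℝ → Y}
    (hγ : IsGeodesic γ) (z : Y) : AntitoneOn (comparisonQuotient γ z) (Set.Ioc 0 1) := by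
  rintro u ⟨hu, -⟩ t ⟨ht, ht1⟩ hut
  have hr : u / t ∈ Set.Icc (0:ℝ) 1 := ⟨by positivity, (div_le_one ht).2 hut⟩
  have h := hY.2 _ (hγ.comp_mul ⟨ht.le, ht1⟩) z (u / t) hr
  have htu : t * (u / t) = u := by field_simp
  simp only [htu, mul_zero, mul_one] at h
  unfold comparisonQuotient
  have hs := hγ.dist_zero (t := u) ⟨hu.le, hut.trans ht1⟩
  rw [hγ.dist_zero ⟨ht.le, ht1⟩] at h ⊢
  rw [hs, div_le_div_iff₀ (by positivity) (by positivity)]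
  have h' := mul_le_mul_of_nonneg_left h ht.le
  have e : t * ((1 - u / t) * dist (γ 0) z ^ 2 + u / t * dist (γ t) z ^ 2
      - u / t * (1 - u / t) * (t * dist (γ 0) (γ 1)) ^ 2)
      = (t - u) * dist (γ 0) z ^ 2 + u * dist (γ t) z ^ 2
        - u * (t - u) * t * dist (γ 0) (γ 1) ^ 2 := by
    field_simp
  rw [e] at h'
  linarith

theorem comparisonQuotient_le {Y : Type*} [MetricSpace Y] {γ : ℝ → Y}
    (hγ : IsGeodesic γ) (z : Y) {t : ℝ} (ht : t ∈ Set.Ioc (0:ℝ) 1) :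
    comparisonQuotient γ z t ≤ dist (γ 0) (γ 1) * dist (γ 0) z := by
  have h := sq_le_sq' (a := dist (γ 0) z - dist (γ 0) (γ t)) (b := dist (γ t) z)
    (by linarith [dist_triangle_right (γ 0) (γ t) z])
    (by linarith [dist_triangle (γ 0) (γ t) z])
  unfold comparisonQuotient
  rw [hγ.dist_zero ⟨ht.1.le, ht.2⟩] at h ⊢
  rw [div_le_iff₀ (by linarith [ht.1])]
  linarith

theorem exists_tendsto_comparisonQuotient {Y : Type*} [MetricSpace Y] (hY : IsCatZero Y)
    {γ : ℝ → Y} (hγ : IsGeodesic γ) (z : Y) :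
    ∃ L, (∀ t ∈ Set.Ioc (0:ℝ) 1, comparisonQuotient γ z t ≤ L) ∧
      Tendsto (comparisonQuotient γ z) (nhdsWithin 0 (Set.Ioi 0)) (nhds L) := by
  have hbdd : BddAbove (comparisonQuotient γ z '' Set.Ioc 0 1) := by
    refine ⟨dist (γ 0) (γ 1) * dist (γ 0) z, ?_⟩
    rintro _ ⟨t, ht, rfl⟩
    exact comparisonQuotient_le hγ z ht
  refine ⟨sSup (comparisonQuotient γ z '' Set.Ioc 0 1),
    fun t ht => le_csSup hbdd ⟨t, ht, rfl⟩, ?_⟩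
  rw [tendsto_order]
  constructor
  · intro a ha
    obtain ⟨_, ⟨u, hu, rfl⟩, hau⟩ := exists_lt_of_lt_csSup
      (Set.Nonempty.image _ ⟨1, by simp⟩) ha
    filter_upwards [Ioc_mem_nhdsGT hu.1] with t ht
    exact hau.trans_le (comparisonQuotient_antitoneOn hY hγ z ⟨ht.1, ht.2.trans hu.2⟩ hu ht.2)
  · intro a ha
    filter_upwards [Ioc_mem_nhdsGT one_pos] with t ht
    exact (le_csSup hbdd ⟨t, ht, rfl⟩).trans_lt ha

theorem tendsto_dist_slope_of_tendsto_comparisonQuotient {Y : Type*} [MetricSpace Y]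
    {γ : ℝ → Y} (hγ : IsGeodesic γ) {z : Y} (hz : γ 0 ≠ z) {L : ℝ}
    (hL : Tendsto (comparisonQuotient γ z) (nhdsWithin 0 (Set.Ioi 0)) (nhds L)) :
    Tendsto (fun t => (dist (γ t) z - dist (γ 0) z) / t) (nhdsWithin 0 (Set.Ioi 0))
      (nhds (-(L / dist (γ 0) z))) := by
  have hb : 0 < dist (γ 0) z := dist_pos.2 hz
  have hid : Tendsto (fun t : ℝ => t) (nhdsWithin 0 (Set.Ioi 0)) (nhds 0) :=
    tendsto_nhdsWithin_of_tendsto_nhds tendsto_id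
  have hγt : Tendsto γ (nhdsWithin 0 (Set.Ioi 0)) (nhds (γ 0)) := by
    rw [tendsto_iff_dist_tendsto_zero]
    have h := hid.mul_const (dist (γ 0) (γ 1))
    rw [zero_mul] at h
    refine h.congr' ?_
    filter_upwards [Ioc_mem_nhdsGT one_pos] with t ht
    rw [dist_comm (γ t), hγ.dist_zero ⟨ht.1.le, ht.2⟩]
  have hd : Tendsto (fun t => dist (γ t) z) (nhdsWithin 0 (Set.Ioi 0)) (nhds (dist (γ 0) z)) :=
    hγt.dist tendsto_const_nhds
  have h := ((hid.mul_const (dist (γ 0) (γ 1) ^ 2)).sub (hL.const_mul 2)).div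
    (hd.add_const (dist (γ 0) z)) (by positivity)
  have e : (0 * dist (γ 0) (γ 1) ^ 2 - 2 * L) / (dist (γ 0) z + dist (γ 0) z)
      = -(L / dist (γ 0) z) := by
    field_simp
    ring
  rw [e] at h
  refine h.congr' ?_
  filter_upwards [Ioc_mem_nhdsGT one_pos] with t ht
  have ht0 : t ≠ 0 := ht.1.ne'
  have hne : dist (γ t) z + dist (γ 0) z ≠ 0 := by positivity
  simp only [Pi.div_apply, comparisonQuotient, hγ.dist_zero ⟨ht.1.le, ht.2⟩]
  field_simp
  ring

/-- **first variation formula.** For geodesics `γ, η` emanating from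
`x` in a CAT(0) space, with `η` nonconstant, the limit
`L₁ = lim_{t→0⁺} (d(γ t, η 1) − d(x, η 1))/t` exists, the joint limit
`L₂ = lim_{t,s→0⁺} (d(x,γ t)² + d(x,η s)² − d(γ t, η s)²)/(2ts)` exists, and
`L₂ = −d(x, η 1) · L₁`. -/
theorem first_variation_formula
    {Y : Type*} [MetricSpace Y] (hY : IsCatZero Y) (x : Y) (γ η : ℝ → Y)
    (hγ : IsGeodesic γ) (hη : IsGeodesic η)
    (hγ0 : γ 0 = x) (hη0 : η 0 = x) (hηnc : η 0 ≠ η 1) :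
    ∃ L₁ L₂ : ℝ,
      Tendsto (fun t : ℝ => (dist (γ t) (η 1) - dist x (η 1)) / t)
        (nhdsWithin 0 (Set.Ioi 0)) (nhds L₁) ∧
      Tendsto (fun p : ℝ × ℝ =>
          (dist x (γ p.1) ^ 2 + dist x (η p.2) ^ 2 - dist (γ p.1) (η p.2) ^ 2)
            / (2 * p.1 * p.2))
        ((nhdsWithin 0 (Set.Ioi 0)) ×ˢ (nhdsWithin 0 (Set.Ioi 0))) (nhds L₂) ∧
      L₂ = -(dist x (η 1)) * L₁ := by
  subst hγ0
  have hb : 0 < dist (γ 0) (η 1) := hη0 ▸ dist_pos.2 hηnc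
  obtain ⟨L, hLle, hL⟩ := exists_tendsto_comparisonQuotient hY hγ (η 1)
  have hslope := tendsto_dist_slope_of_tendsto_comparisonQuotient hγ (dist_pos.1 hb) hL
  refine ⟨_, L, hslope, ?_, by field_simp⟩
  have hfst : Tendsto (fun p : ℝ × ℝ => comparisonQuotient γ (η 1) p.1)
      ((nhdsWithin 0 (Set.Ioi 0)) ×ˢ (nhdsWithin 0 (Set.Ioi 0))) (nhds L) :=
    hL.comp tendsto_fst
  have hmem : ∀ᶠ p : ℝ × ℝ in (nhdsWithin 0 (Set.Ioi 0)) ×ˢ (nhdsWithin 0 (Set.Ioi 0)),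
      p.1 ∈ Set.Ioc (0:ℝ) 1 ∧ p.2 ∈ Set.Ioc (0:ℝ) 1 :=
    prod_mem_prod (Ioc_mem_nhdsGT one_pos) (Ioc_mem_nhdsGT one_pos)
  refine tendsto_of_tendsto_of_tendsto_of_le_of_le' hfst tendsto_const_nhds ?_ ?_
  · filter_upwards [hmem] with ⟨t, s⟩ ⟨ht, hs⟩
    have h := comparisonQuotient_antitoneOn hY hη (γ t) hs ⟨one_pos, le_rfl⟩ hs.2
    have h' := div_le_div_of_nonneg_right h ht.1.le
    simp only [comparisonQuotient, hη0, dist_comm (η _) (γ t)] at h' ⊢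
    convert h' using 1
    · ring
    · have := ht.1.ne'
      have := hs.1.ne'
      field_simp
      ring
  · filter_upwards [hmem] with ⟨t, s⟩ ⟨ht, hs⟩
    have hs0 : 0 < s := hs.1
    have hds : dist (γ 0) (η s) = s * dist (γ 0) (η 1) := by
      rw [← hη0, hη.dist_zero ⟨hs.1.le, hs.2⟩]
    obtain ⟨M, hMle, hM⟩ := exists_tendsto_comparisonQuotient hY hγ (η s)
    have hslope' := tendsto_dist_slope_of_tendsto_comparisonQuotient hγ
      (z := η s) (dist_pos.1 (by rw [hds]; positivity)) hM
    have hLM : -(L / dist (γ 0) (η 1)) ≤ -(M / dist (γ 0) (η s)) := by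
      refine le_of_tendsto_of_tendsto hslope hslope' ?_
      filter_upwards [self_mem_nhdsWithin] with u hu
      refine div_le_div_of_nonneg_right ?_ (le_of_lt hu)
      have h1 := hη s ⟨hs.1.le, hs.2⟩ 1 ⟨zero_le_one, le_rfl⟩
      rw [abs_sub_comm, abs_of_nonneg (sub_nonneg.2 hs.2), hη0] at h1
      linarith [dist_triangle (γ u) (η s) (η 1)]
    rw [hds, neg_le_neg_iff, div_le_div_iff₀ (by positivity) hb] at hLM
    have hML : M ≤ L * s := by
      refine le_of_mul_le_mul_right ?_ hb
      linarith
    have h := (hMle t ht).trans hML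
    rw [← div_le_iff₀ hs0, comparisonQuotient, div_div] at h
    exact h
end

section
/- Let Y be a metric space, B ⊆ Y, and G : B × B × [0,1] → B a continuous map such that for all x, y ∈ B, G(x,y,0) = x, G(x,y,1) = y, and d(G(x,y,s), G(x,y,t)) = |s − t|·d(x,y) for all s, t ∈ [0,1] (i.e. G(x,y,·) is a geodesic from x to y lying in B). If C ⊆ B is separable, then the smallest closed subset S of B containing C and satisfying G(x,y,t) ∈ S for all x, y ∈ S and t ∈ [0,1] is separable. -/
/-- The image of a separable subset of a metric space under a map continuous on it is separable. -/
theorem TopologicalSpace.IsSeparable.image_of_continuousOn {X Z : Type*} [PseudoMetricSpace X]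
    [TopologicalSpace Z] {f : X → Z} {s : Set X} (hs : TopologicalSpace.IsSeparable s)
    (hf : ContinuousOn f s) : TopologicalSpace.IsSeparable (f '' s) := by
  have := hs.separableSpace
  rw [Set.image_eq_range]
  exact TopologicalSpace.isSeparable_range hf.domRestrict

/-- The points joining pairs of points of `A` along the bicombing `G`, together with `A`. -/
def geodesicStep {Y : Type*} (G : Y → Y → ℝ → Y) (A : Set Y) : Set Y :=
  A ∪ (fun p : Y × Y × ℝ => G p.1 p.2.1 p.2.2) '' (A ×ˢ A ×ˢ Set.Icc (0:ℝ) 1)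

/-- **separable convex hull.** Let `B ⊆ Y` and let `G` be a continuous
choice of geodesics in `B`. If `C ⊆ B` is separable, then the smallest relatively
closed `G`-convex subset of `B` containing `C` is separable. -/
theorem separable_convex_hull
    {Y : Type*} [MetricSpace Y] (B : Set Y) (G : Y → Y → ℝ → Y)
    (hGmem : ∀ x ∈ B, ∀ y ∈ B, ∀ t ∈ Set.Icc (0:ℝ) 1, G x y t ∈ B)
    (hG0 : ∀ x ∈ B, ∀ y ∈ B, G x y 0 = x)
    (hG1 : ∀ x ∈ B, ∀ y ∈ B, G x y 1 = y)
    (hGgeo : ∀ x ∈ B, ∀ y ∈ B, ∀ s ∈ Set.Icc (0:ℝ) 1, ∀ t ∈ Set.Icc (0:ℝ) 1,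
      dist (G x y s) (G x y t) = |s - t| * dist x y)
    (hGcont : ContinuousOn (fun p : Y × Y × ℝ => G p.1 p.2.1 p.2.2)
      (B ×ˢ B ×ˢ Set.Icc (0:ℝ) 1))
    (C : Set Y) (hCB : C ⊆ B) (hCsep : TopologicalSpace.IsSeparable C)
    (S : Set Y)
    (hSB : S ⊆ B) (hCS : C ⊆ S)
    (hSclosed : closure S ∩ B ⊆ S)
    (hSconv : ∀ x ∈ S, ∀ y ∈ S, ∀ t ∈ Set.Icc (0:ℝ) 1, G x y t ∈ S)
    (hSmin : ∀ T : Set Y, T ⊆ B → C ⊆ T → closure T ∩ B ⊆ T →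
      (∀ x ∈ T, ∀ y ∈ T, ∀ t ∈ Set.Icc (0:ℝ) 1, G x y t ∈ T) → S ⊆ T) :
    TopologicalSpace.IsSeparable S := by
  let D : ℕ → Set Y := fun n => (geodesicStep G)^[n] C
  have hDsucc (n : ℕ) : D (n + 1) = geodesicStep G (D n) :=
    Function.iterate_succ_apply' _ _ _
  have hDB (n : ℕ) : D n ⊆ B := by
    induction n with
    | zero => exact hCB
    | succ n ih =>
      rw [hDsucc]
      rintro z (hz | ⟨⟨x, y, t⟩, ⟨hx, hy, ht⟩, rfl⟩)
      · exact ih hz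
      · exact hGmem x (ih hx) y (ih hy) t ht
  have hDsep (n : ℕ) : TopologicalSpace.IsSeparable (D n) := by
    induction n with
    | zero => exact hCsep
    | succ n ih =>
      rw [hDsucc]
      refine ih.union (TopologicalSpace.IsSeparable.image_of_continuousOn
        (ih.prod (ih.prod (TopologicalSpace.IsSeparable.of_separableSpace _))) ?_)
      exact hGcont.mono (Set.prod_mono (hDB n) (Set.prod_mono (hDB n) subset_rfl))
  have hDmono : Monotone D := monotone_nat_of_le_succ fun n => by
    rw [hDsucc]
    exact Set.subset_union_left
  let A : Set Y := ⋃ n, D n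
  have hAB : A ⊆ B := Set.iUnion_subset hDB
  have hAsep : TopologicalSpace.IsSeparable A := .iUnion hDsep
  have hAconv : Set.MapsTo (fun p : Y × Y × ℝ => G p.1 p.2.1 p.2.2)
      (A ×ˢ A ×ˢ Set.Icc (0:ℝ) 1) A := by
    rintro ⟨x, y, t⟩ ⟨hx, hy, ht⟩
    obtain ⟨m, hm⟩ := Set.mem_iUnion.1 hx
    obtain ⟨n, hn⟩ := Set.mem_iUnion.1 hy
    refine Set.mem_iUnion.2 ⟨max m n + 1, ?_⟩
    rw [hDsucc]
    exact Or.inr ⟨(x, y, t),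
      ⟨hDmono (le_max_left m n) hm, hDmono (le_max_right m n) hn, ht⟩, rfl⟩
  have hCA : C ⊆ A := Set.subset_iUnion D 0
  refine hAsep.closure.mono ((hSmin (closure A ∩ B) Set.inter_subset_right
    (fun x hx => ⟨subset_closure (hCA hx), hCB hx⟩) ?_ ?_).trans Set.inter_subset_left)
  · exact Set.inter_subset_inter_left _
      (closure_minimal Set.inter_subset_left isClosed_closure)
  · rintro x ⟨hxA, hxB⟩ y ⟨hyA, hyB⟩ t ht
    refine ⟨?_, hGmem x hxB y hyB t ht⟩
    refine ((hGcont (x, y, t) ⟨hxB, hyB, ht⟩).mono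
      (Set.prod_mono hAB (Set.prod_mono hAB subset_rfl))).mem_closure ?_ hAconv
    rw [closure_prod_eq, closure_prod_eq]
    exact ⟨hxA, hyA, subset_closure ht⟩
end

section
/- Let Y be a metric space, μ a Borel probability measure on Y, and b, p ∈ Y such that ∫ d(x,p) dμ(x) < ∞. Assume the variance inequality ∫ (d(x,p)² − d(x,b)²) dμ(x) ≥ d(p,b)², and assume d(b,p) ≥ ∫ d(x,p) dμ(x). Then for μ-almost every x ∈ Y one has d(x,b) = |d(x,p) − d(b,p)|. -/
open MeasureTheory

/-- The difference of the squared distances to two points is integrable as soon as the distance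
to one of them is. -/
theorem integrable_dist_sq_sub_dist_sq
    {Y : Type*} [MetricSpace Y] [MeasurableSpace Y] [OpensMeasurableSpace Y]
    {μ : Measure Y} [IsFiniteMeasure μ] {p : Y}
    (hmom : Integrable (fun x => dist x p) μ) (b : Y) :
    Integrable (fun x => dist x p ^ 2 - dist x b ^ 2) μ := by
  have hbound : Integrable (fun x => dist b p * (2 * dist x p + dist b p)) μ :=
    ((hmom.const_mul 2).add (integrable_const _)).const_mul _
  have hcont : Continuous fun x : Y => dist x p ^ 2 - dist x b ^ 2 := by fun_prop
  refine hbound.mono' hcont.measurable.aestronglyMeasurable (.of_forall fun x => ?_)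
  have h₁ : |dist x p - dist x b| ≤ dist b p := by
    simpa only [dist_comm x, dist_comm b p] using abs_dist_sub_le p b x
  have h₂ : dist x b ≤ dist x p + dist b p := dist_triangle_right x b p
  rw [Real.norm_eq_abs, sq_sub_sq, abs_mul, mul_comm,
    abs_of_nonneg (a := dist x p + dist x b) (by positivity)]
  exact mul_le_mul h₁ (by linarith) (by positivity) dist_nonneg

/-- **rigidity for barycenters.** If `μ` is a Borel probability measure
on a metric space with finite first moment, `b` satisfies the variance inequality at
`p`, and `d(b,p) ≥ ∫ d(x,p) dμ(x)`, then `d(x,b) = |d(x,p) − d(b,p)|` for μ-a.e. `x`. -/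
theorem barycenter_rigidity
    {Y : Type*} [MetricSpace Y] [MeasurableSpace Y] [OpensMeasurableSpace Y]
    (μ : Measure Y) [IsProbabilityMeasure μ] (b p : Y)
    (hmom : Integrable (fun x => dist x p) μ)
    (hvar : dist p b ^ 2 ≤ ∫ x, (dist x p ^ 2 - dist x b ^ 2) ∂μ)
    (hbar : ∫ x, dist x p ∂μ ≤ dist b p) :
    ∀ᵐ x ∂μ, dist x b = |dist x p - dist b p| := by
  have hint := integrable_dist_sq_sub_dist_sq hmom b
  have hlin : Integrable (fun x => 2 * dist b p * dist x p - dist b p ^ 2) μ :=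
    (hmom.const_mul _).sub (integrable_const _)
  have habs (x : Y) : |dist x p - dist b p| ≤ dist x b := abs_dist_sub_le x b p
  have hle (x : Y) :
      dist x p ^ 2 - dist x b ^ 2 ≤ 2 * dist b p * dist x p - dist b p ^ 2 := by
    have := sq_le_sq' (neg_le_of_abs_le (habs x)) (le_of_abs_le (habs x))
    linarith
  have hlin_eq : ∫ x, (2 * dist b p * dist x p - dist b p ^ 2) ∂μ =
      2 * dist b p * ∫ x, dist x p ∂μ - dist b p ^ 2 := by
    rw [integral_sub (hmom.const_mul _) (integrable_const _), integral_const_mul]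
    simp
  have heq : ∫ x, (dist x p ^ 2 - dist x b ^ 2) ∂μ =
      ∫ x, (2 * dist b p * dist x p - dist b p ^ 2) ∂μ := by
    refine le_antisymm (integral_mono hint hlin hle) ?_
    rw [dist_comm p b] at hvar
    rw [hlin_eq]
    nlinarith [mul_le_mul_of_nonneg_left hbar (dist_nonneg (x := b) (y := p))]
  filter_upwards [(integral_eq_iff_of_ae_le hint hlin (.of_forall hle)).1 heq] with x hx
  rw [← abs_of_nonneg (dist_nonneg (x := x) (y := b)), ← sq_eq_sq_iff_abs_eq_abs]
  linarith
end

section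
/- Let Y be a metric space and γ, η : [0,1] → Y continuous curves. Suppose that for every ε > 0 there exist reparametrizations α, β : [0,1] → [0,1] such that sup_{t∈[0,1]} d(γ(α(t)), η(β(t))) ≤ ε. Then there exist reparametrizations α, β : [0,1] → [0,1] with γ ∘ α = η ∘ β. -/
/-- A reparametrization: a non-decreasing continuous surjection of `[0,1]` onto
itself (viewed as a map `ℝ → ℝ`). -/
def IsReparam (α : ℝ → ℝ) : Prop :=
  ContinuousOn α (Set.Icc (0:ℝ) 1) ∧ MonotoneOn α (Set.Icc (0:ℝ) 1) ∧
    α '' Set.Icc (0:ℝ) 1 = Set.Icc (0:ℝ) 1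

/-- A reparametrization fixes the endpoints of the unit interval. -/
lemma IsReparam.endpoints {α : ℝ → ℝ} (h : IsReparam α) : α 0 = 0 ∧ α 1 = 1 := by
  obtain ⟨-, hm, hi⟩ := h
  have h0 : (0:ℝ) ∈ Set.Icc (0:ℝ) 1 := by simp
  have h1 : (1:ℝ) ∈ Set.Icc (0:ℝ) 1 := by simp
  have m0 : α 0 ∈ Set.Icc (0:ℝ) 1 := hi ▸ Set.mem_image_of_mem α h0
  have m1 : α 1 ∈ Set.Icc (0:ℝ) 1 := hi ▸ Set.mem_image_of_mem α h1
  obtain ⟨x, hx, hx0⟩ : (0:ℝ) ∈ α '' Set.Icc (0:ℝ) 1 := by rwa [hi]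
  obtain ⟨y, hy, hy1⟩ : (1:ℝ) ∈ α '' Set.Icc (0:ℝ) 1 := by rwa [hi]
  have := hm h0 hx hx.1
  have := hm hy h1 hy.2
  constructor <;> linarith [m0.1, m1.2]

/-- A continuous non-decreasing self-map fixing the endpoints is a reparametrization. -/
lemma IsReparam.of_endpoints {α : ℝ → ℝ} (hc : ContinuousOn α (Set.Icc (0:ℝ) 1))
    (hm : MonotoneOn α (Set.Icc (0:ℝ) 1)) (h0 : α 0 = 0) (h1 : α 1 = 1) : IsReparam α := by
  refine ⟨hc, hm, Set.Subset.antisymm ?_ ?_⟩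
  · rintro _ ⟨x, hx, rfl⟩
    exact ⟨h0 ▸ hm (by simp) hx hx.1, h1 ▸ hm hx (by simp) hx.2⟩
  · have := intermediate_value_Icc zero_le_one hc
    rwa [h0, h1] at this

/-- `a` and `s ↦ 2 * s - a s` are non-decreasing self-maps of the unit interval. -/
structure IsBalanced (a : ℝ → ℝ) : Prop where
  mem : ∀ s ∈ Set.Icc (0:ℝ) 1, a s ∈ Set.Icc (0:ℝ) 1
  mem_compl : ∀ s ∈ Set.Icc (0:ℝ) 1, 2 * s - a s ∈ Set.Icc (0:ℝ) 1
  mono : MonotoneOn a (Set.Icc (0:ℝ) 1)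
  mono_compl : MonotoneOn (fun s => 2 * s - a s) (Set.Icc (0:ℝ) 1)

lemma IsBalanced.isReparam {a : ℝ → ℝ} (h : IsBalanced a) :
    IsReparam a ∧ IsReparam (fun s => 2 * s - a s) := by
  have hc : ContinuousOn a (Set.Icc (0:ℝ) 1) := by
    refine (LipschitzOnWith.of_le_add_mul 2 fun x hx y hy => ?_).continuousOn
    rcases le_total x y with hxy | hxy
    · have := h.mono hx hy hxy
      have := dist_nonneg (x := x) (y := y)
      push_cast
      linarith
    · have := h.mono_compl hy hx hxy
      have : dist x y = x - y := by rw [Real.dist_eq, abs_of_nonneg (by linarith)]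
      push_cast
      simp only at *
      linarith
  have h0 : a 0 = 0 := by
    linarith [(h.mem 0 (by simp)).1, (h.mem_compl 0 (by simp)).1]
  have h1 : a 1 = 1 := by
    linarith [(h.mem 1 (by simp)).2, (h.mem_compl 1 (by simp)).2]
  exact ⟨.of_endpoints hc h.mono h0 h1,
    .of_endpoints (by fun_prop) h.mono_compl (by simp [h0]) (by norm_num [h1])⟩

/-- Any pair of reparametrizations can be reparametrized by its mean. -/
lemma IsReparam.exists_isBalanced {α β : ℝ → ℝ} (hα : IsReparam α) (hβ : IsReparam β) :
    ∃ a : ℝ → ℝ, IsBalanced a ∧ ∀ s ∈ Set.Icc (0:ℝ) 1, ∃ t ∈ Set.Icc (0:ℝ) 1,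
      a s = α t ∧ 2 * s - a s = β t := by
  have key : ∀ s ∈ Set.Icc (0:ℝ) 1, ∃ t ∈ Set.Icc (0:ℝ) 1, α t + β t = 2 * s := by
    intro s hs
    have hv := intermediate_value_Icc zero_le_one (hα.1.add hβ.1)
    simp only [Pi.add_apply, hα.endpoints.1, hα.endpoints.2, hβ.endpoints.1,
      hβ.endpoints.2] at hv
    exact hv ⟨by linarith [hs.1], by linarith [hs.2]⟩
  choose! τ hτ hτs using key
  have hτb (s) (hs : s ∈ Set.Icc (0:ℝ) 1) : 2 * s - α (τ s) = β (τ s) := by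
    linarith [hτs s hs]
  have hmono : MonotoneOn τ (Set.Icc (0:ℝ) 1) := by
    intro x hx y hy hxy
    by_contra! hlt
    have h1 := hα.2.1 (hτ y hy) (hτ x hx) hlt.le
    have h2 := hβ.2.1 (hτ y hy) (hτ x hx) hlt.le
    have : x = y := by linarith [hτs x hx, hτs y hy]
    exact hlt.ne (by rw [this])
  refine ⟨fun s => α (τ s), ⟨fun s hs => ?_, fun s hs => ?_, ?_, ?_⟩,
    fun s hs => ⟨τ s, hτ s hs, rfl, hτb s hs⟩⟩
  · exact hα.2.2 ▸ Set.mem_image_of_mem α (hτ s hs)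
  · rw [hτb s hs]
    exact hβ.2.2 ▸ Set.mem_image_of_mem β (hτ s hs)
  · exact fun x hx y hy hxy => hα.2.1 (hτ x hx) (hτ y hy) (hmono hx hy hxy)
  · intro x hx y hy hxy
    simp only [hτb x hx, hτb y hy]
    exact hβ.2.1 (hτ x hx) (hτ y hy) (hmono hx hy hxy)

open Filter Topology in
/-- Balanced functions are closed under pointwise limits. -/
lemma IsBalanced.of_tendsto {ι : Type*} {l : Filter ι} [l.NeBot] {u : ι → ℝ → ℝ} {a : ℝ → ℝ}
    (hu : ∀ i, IsBalanced (u i))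
    (ha : ∀ s ∈ Set.Icc (0:ℝ) 1, Tendsto (fun i => u i s) l (𝓝 (a s))) : IsBalanced a where
  mem s hs := isClosed_Icc.mem_of_tendsto (ha s hs) (.of_forall fun i => (hu i).mem s hs)
  mem_compl s hs := isClosed_Icc.mem_of_tendsto ((ha s hs).const_sub _)
    (.of_forall fun i => (hu i).mem_compl s hs)
  mono x hx y hy hxy := le_of_tendsto_of_tendsto' (ha x hx) (ha y hy)
    fun i => (hu i).mono hx hy hxy
  mono_compl x hx y hy hxy := le_of_tendsto_of_tendsto' ((ha x hx).const_sub _)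
    ((ha y hy).const_sub _) fun i => (hu i).mono_compl hx hy hxy

open Filter Topology in
/-- Every sequence of balanced functions converges pointwise along the hyperfilter. -/
lemma IsBalanced.exists_tendsto_hyperfilter {u : ℕ → ℝ → ℝ} (hu : ∀ n, IsBalanced (u n)) :
    ∃ a : ℝ → ℝ, ∀ s ∈ Set.Icc (0:ℝ) 1,
      Tendsto (fun n => u n s) (hyperfilter ℕ) (𝓝 (a s)) := by
  have key : ∀ s ∈ Set.Icc (0:ℝ) 1,
      ∃ x, Tendsto (fun n => u n s) (hyperfilter ℕ) (𝓝 x) := by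
    intro s hs
    obtain ⟨x, -, hx⟩ := isCompact_Icc.ultrafilter_le_nhds
      ((hyperfilter ℕ).map fun n => u n s)
      (le_principal_iff.2 (Ultrafilter.mem_map.2 (univ_mem' fun n => (hu n).mem s hs)))
    exact ⟨x, hx⟩
  choose! a ha using key
  exact ⟨a, ha⟩

/-- If two continuous curves can be reparametrized to be uniformly
`ε`-close for every `ε > 0`, then they admit a common reparametrized representative. -/
theorem zero_reparam_distance_implies_common_reparam
    {Y : Type*} [MetricSpace Y] (γ η : ℝ → Y)
    (hγ : ContinuousOn γ (Set.Icc (0:ℝ) 1)) (hη : ContinuousOn η (Set.Icc (0:ℝ) 1))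
    (hclose : ∀ ε : ℝ, 0 < ε → ∃ α β : ℝ → ℝ, IsReparam α ∧ IsReparam β ∧
      ∀ t ∈ Set.Icc (0:ℝ) 1, dist (γ (α t)) (η (β t)) ≤ ε) :
    ∃ α β : ℝ → ℝ, IsReparam α ∧ IsReparam β ∧
      ∀ t ∈ Set.Icc (0:ℝ) 1, γ (α t) = η (β t) := by
  have key (n : ℕ) : ∃ a : ℝ → ℝ, IsBalanced a ∧
      ∀ s ∈ Set.Icc (0:ℝ) 1, dist (γ (a s)) (η (2 * s - a s)) ≤ 1 / ((n:ℝ) + 1) := by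
    obtain ⟨α, β, hα, hβ, hd⟩ := hclose (1 / ((n:ℝ) + 1)) (by positivity)
    obtain ⟨a, ha, hat⟩ := hα.exists_isBalanced hβ
    refine ⟨a, ha, fun s hs => ?_⟩
    obtain ⟨t, ht, h1, h2⟩ := hat s hs
    rw [h1] at h2 ⊢
    rw [h2]
    exact hd t ht
  choose u hu hd using key
  obtain ⟨a, ha⟩ := IsBalanced.exists_tendsto_hyperfilter hu
  have hab : IsBalanced a := .of_tendsto hu ha
  refine ⟨a, fun s => 2 * s - a s, hab.isReparam.1, hab.isReparam.2, fun s hs => ?_⟩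
  have hγs := (hγ _ (hab.mem s hs)).tendsto.comp
    (tendsto_nhdsWithin_iff.2 ⟨ha s hs, .of_forall fun n => (hu n).mem s hs⟩)
  have hηs := (hη _ (hab.mem_compl s hs)).tendsto.comp
    (tendsto_nhdsWithin_iff.2
      ⟨(ha s hs).const_sub (2 * s), .of_forall fun n => (hu n).mem_compl s hs⟩)
  have hlim := (tendsto_one_div_add_atTop_nhds_zero_nat (𝕜 := ℝ)).mono_left
    Nat.hyperfilter_le_atTop
  exact dist_le_zero.1 (le_of_tendsto_of_tendsto' (hγs.dist hηs) hlim fun n => hd n s hs)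
end

section
/- Let Y be a metric space and let γₙ, γ : [0,1] → Y be continuous curves of finite positive length ℓₙ := ℓ(γₙ) and ℓ := ℓ(γ). Assume: (i) γ is parametrized with constant speed, i.e. ℓ(γ restricted to [0,t]) = t·ℓ for every t ∈ [0,1]; (ii) γₙ → γ uniformly on [0,1]; (iii) ℓₙ → ℓ. For each n let γ̄ₙ : [0,1] → Y be the constant-speed reparametrization of γₙ, i.e. γ̄ₙ is ℓₙ-Lipschitz and γ̄ₙ(ℓ(γₙ restricted to [0,t]) / ℓₙ) = γₙ(t) for every t ∈ [0,1]. Then γ̄ₙ → γ uniformly on [0,1]. -/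
open Filter

/-- If `F i → f` pointwise on `[a, c]` and the variations of `F i` on `[a, c]` converge to that of
`f`, which is finite, then the variations on every initial segment `[a, b]` converge as well. -/
theorem tendsto_eVariationOn_Icc_left_of_tendsto {ι α E : Type*} [LinearOrder α]
    [PseudoEMetricSpace E] {p : Filter ι} {F : ι → α → E} {f : α → E} {a b c : α}
    (hab : a ≤ b) (hbc : b ≤ c)
    (hF : ∀ x ∈ Set.Icc a c, Tendsto (fun i => F i x) p (nhds (f x)))
    (hf : BoundedVariationOn f (Set.Icc a c))
    (hvar : Tendsto (fun i => eVariationOn (F i) (Set.Icc a c)) p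
      (nhds (eVariationOn f (Set.Icc a c)))) :
    Tendsto (fun i => eVariationOn (F i) (Set.Icc a b)) p
      (nhds (eVariationOn f (Set.Icc a b))) := by
  have split (g : α → E) : eVariationOn g (Set.Icc a b) + eVariationOn g (Set.Icc b c) =
      eVariationOn g (Set.Icc a c) := by
    simpa using eVariationOn.Icc_add_Icc g (s := Set.univ) hab hbc (Set.mem_univ b)
  have hright : eVariationOn f (Set.Icc b c) ≠ ⊤ := hf.mono (Set.Icc_subset_Icc_left hab)
  have hmin : Tendsto
      (fun i => min (eVariationOn (F i) (Set.Icc b c)) (eVariationOn f (Set.Icc b c))) p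
      (nhds (eVariationOn f (Set.Icc b c))) := by
    refine tendsto_order.2 ⟨fun v hv => ?_, fun v hv => .of_forall fun i => min_lt_of_right_lt hv⟩
    filter_upwards [eVariationOn.lowerSemicontinuous_aux
      (fun x hx => hF x (Set.Icc_subset_Icc_left hab hx)) hv] with i hi
    exact lt_min hi hv
  have hsub := ENNReal.Tendsto.sub hvar hmin (.inr hright)
  rw [← split f, ENNReal.add_sub_cancel_right hright] at hsub
  refine tendsto_order.2 ⟨fun v hv => eVariationOn.lowerSemicontinuous_aux
    (fun x hx => hF x (Set.Icc_subset_Icc_right hbc hx)) hv, fun v hv => ?_⟩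
  filter_upwards [hsub.eventually_lt_const hv] with i hi
  refine lt_of_le_of_lt (ENNReal.le_sub_of_add_le_right
    (ne_top_of_le_ne_top hright (min_le_right _ _)) ?_) hi
  rw [← split (F i)]
  gcongr
  exact min_le_left _ _

/-- Monotone functions on `[0, 1]` converging pointwise to the identity converge uniformly. -/
theorem tendstoUniformlyOn_id_of_monotoneOn {ι : Type*} {p : Filter ι} {F : ι → ℝ → ℝ}
    (hmono : ∀ i, MonotoneOn (F i) (Set.Icc 0 1))
    (hF : ∀ x ∈ Set.Icc (0 : ℝ) 1, Tendsto (fun i => F i x) p (nhds x)) :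
    TendstoUniformlyOn F id p (Set.Icc 0 1) := by
  rw [Metric.tendstoUniformlyOn_iff]
  intro ε hε
  obtain ⟨N, hN⟩ := exists_nat_one_div_lt (half_pos hε)
  have hM : (0 : ℝ) < N + 1 := by positivity
  have hgrid {k : ℕ} (hk : k ≤ N + 1) : (k : ℝ) / (N + 1) ∈ Set.Icc (0 : ℝ) 1 :=
    ⟨by positivity, (div_le_one hM).2 (by exact_mod_cast hk)⟩
  have hev : ∀ᶠ i in p, ∀ k ∈ Finset.range (N + 2),
      dist (F i ((k : ℝ) / (N + 1))) ((k : ℝ) / (N + 1)) < ε / 2 := by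
    refine (Finset.eventually_all _).2 fun k hk => ?_
    exact Metric.tendsto_nhds.1 (hF _ (hgrid (by grind))) _ (half_pos hε)
  filter_upwards [hev] with i hi x hx
  have hxM : 0 ≤ x * (N + 1) := mul_nonneg hx.1 hM.le
  have hceil : ⌈x * (N + 1)⌉₊ ≤ N + 1 := by
    refine Nat.ceil_le.2 ?_
    push_cast
    nlinarith [hx.2]
  have hfloor : ⌊x * (N + 1)⌋₊ ≤ N + 1 := (Nat.floor_le_ceil _).trans hceil
  have hle : (⌊x * (N + 1)⌋₊ : ℝ) / (N + 1) ≤ x := (div_le_iff₀ hM).2 (Nat.floor_le hxM)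
  have hge : x ≤ (⌈x * (N + 1)⌉₊ : ℝ) / (N + 1) := (le_div_iff₀ hM).2 (Nat.le_ceil _)
  have hle' : x - 1 / (N + 1) ≤ (⌊x * (N + 1)⌋₊ : ℝ) / (N + 1) := by
    rw [le_div_iff₀ hM, sub_mul, one_div_mul_cancel hM.ne']
    linarith [Nat.lt_floor_add_one (x * ((N : ℝ) + 1))]
  have hge' : (⌈x * (N + 1)⌉₊ : ℝ) / (N + 1) ≤ x + 1 / (N + 1) := by
    rw [div_le_iff₀ hM, add_mul, one_div_mul_cancel hM.ne']
    exact (Nat.ceil_lt_add_one hxM).le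
  have h₁ := hmono i (hgrid hfloor) hx hle
  have h₂ := hmono i hx (hgrid hceil) hge
  have h₃ := abs_lt.1 (hi _ (Finset.mem_range.2 (Nat.lt_succ_of_le hfloor)))
  have h₄ := abs_lt.1 (hi _ (Finset.mem_range.2 (Nat.lt_succ_of_le hceil)))
  rw [id, dist_comm, Real.dist_eq, abs_lt]
  constructor <;> linarith [h₃.1, h₄.2]

/-- If curves `γₙ` of finite positive length `ℓₙ` converge uniformly
to a constant-speed curve `γ` of length `ℓ`, and `ℓₙ → ℓ`, then the constant-speed
reparametrizations `γ̄ₙ` of the `γₙ` also converge uniformly to `γ`. -/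
theorem constant_speed_reparam_uniform_convergence
    {Y : Type*} [MetricSpace Y]
    (γseq : ℕ → ℝ → Y) (γ : ℝ → Y) (ℓseq : ℕ → ℝ) (ℓ : ℝ)
    (hcont : ∀ n, ContinuousOn (γseq n) (Set.Icc (0:ℝ) 1))
    (hℓpos : 0 < ℓ) (hℓseqpos : ∀ n, 0 < ℓseq n)
    (hlen : ∀ n, eVariationOn (γseq n) (Set.Icc (0:ℝ) 1) = ENNReal.ofReal (ℓseq n))
    (hconstspeed : ∀ t ∈ Set.Icc (0:ℝ) 1,
      eVariationOn γ (Set.Icc (0:ℝ) t) = ENNReal.ofReal (t * ℓ))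
    (hunif : TendstoUniformlyOn (fun n t => γseq n t) γ atTop (Set.Icc (0:ℝ) 1))
    (hℓconv : Tendsto ℓseq atTop (nhds ℓ))
    (γbar : ℕ → ℝ → Y)
    (hbarlip : ∀ n, LipschitzOnWith (Real.toNNReal (ℓseq n)) (γbar n) (Set.Icc (0:ℝ) 1))
    (hbarrep : ∀ n, ∀ t ∈ Set.Icc (0:ℝ) 1,
      γbar n ((eVariationOn (γseq n) (Set.Icc (0:ℝ) t)).toReal / ℓseq n) = γseq n t) :
    TendstoUniformlyOn (fun n t => γbar n t) γ atTop (Set.Icc (0:ℝ) 1) := by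
  have hone : (1 : ℝ) ∈ Set.Icc (0 : ℝ) 1 := ⟨zero_le_one, le_rfl⟩
  have hlenγ : eVariationOn γ (Set.Icc (0 : ℝ) 1) = ENNReal.ofReal ℓ := by
    simpa using hconstspeed 1 hone
  have hbv : BoundedVariationOn γ (Set.Icc (0 : ℝ) 1) := by
    simp [BoundedVariationOn, hlenγ]
  have hbvseq n : BoundedVariationOn (γseq n) (Set.Icc (0 : ℝ) 1) := by
    simp [BoundedVariationOn, hlen n]
  have hvar : Tendsto (fun n => eVariationOn (γseq n) (Set.Icc (0 : ℝ) 1)) atTop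
      (nhds (eVariationOn γ (Set.Icc (0 : ℝ) 1))) := by
    simpa only [hlen, hlenγ] using ENNReal.tendsto_ofReal hℓconv
  set σ : ℕ → ℝ → ℝ :=
    fun n t => (eVariationOn (γseq n) (Set.Icc (0 : ℝ) t)).toReal / ℓseq n with hσ
  have hmono n : MonotoneOn (σ n) (Set.Icc 0 1) := fun s hs t ht hst =>
    div_le_div_of_nonneg_right
      (ENNReal.toReal_mono ((hbvseq n).mono (Set.Icc_subset_Icc_right ht.2))
        (eVariationOn.mono _ (Set.Icc_subset_Icc_right hst))) (hℓseqpos n).le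
  have hσmem n t (ht : t ∈ Set.Icc (0 : ℝ) 1) : σ n t ∈ Set.Icc (0 : ℝ) 1 := by
    refine ⟨div_nonneg ENNReal.toReal_nonneg (hℓseqpos n).le, (hmono n ht hone ht.2).trans ?_⟩
    simp [hσ, hlen n, (hℓseqpos n).le, (hℓseqpos n).ne']
  have hσtendsto : ∀ t ∈ Set.Icc (0 : ℝ) 1, Tendsto (fun n => σ n t) atTop (nhds t) := by
    intro t ht
    have h := tendsto_eVariationOn_Icc_left_of_tendsto ht.1 ht.2
      (fun x hx => hunif.tendsto_at hx) hbv hvar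
    rw [hconstspeed t ht] at h
    have h' := ((ENNReal.tendsto_toReal ENNReal.ofReal_ne_top).comp h).div hℓconv hℓpos.ne'
    rwa [ENNReal.toReal_ofReal (mul_nonneg ht.1 hℓpos.le), mul_div_cancel_right₀ _ hℓpos.ne'] at h'
  have hσunif := tendstoUniformlyOn_id_of_monotoneOn hmono hσtendsto
  rw [Metric.tendstoUniformlyOn_iff] at hunif hσunif ⊢
  intro ε hε
  have hδ : 0 < ε / 2 / (ℓ + 1) := by positivity
  filter_upwards [hunif _ (half_pos hε), hσunif _ hδ,
    hℓconv.eventually_lt_const (lt_add_one ℓ)] with n hγn hσn hℓn t ht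
  have hlip : dist (γseq n t) (γbar n t) ≤ ℓseq n * dist t (σ n t) := by
    have h := (hbarlip n).dist_le_mul _ (hσmem n t ht) _ ht
    rwa [hbarrep n t ht, Real.coe_toNNReal _ (hℓseqpos n).le, dist_comm (σ n t)] at h
  have hlt : ℓseq n * dist t (σ n t) ≤ ε / 2 := by
    calc ℓseq n * dist t (σ n t) ≤ (ℓ + 1) * (ε / 2 / (ℓ + 1)) := by
          gcongr
          exact (hσn t ht).le
      _ = ε / 2 := by field_simp
  linarith [dist_triangle (γ t) (γseq n t) (γbar n t), hγn t ht]
end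

section
/- Let Y be a complete separable metric space, L > 0, g : Y → ℝ a bounded Lipschitz function and f : Y → ℝ a Lipschitz function. Consider the set Lip_L := {γ ∈ C([0,1]; Y) : γ is L-Lipschitz}, equipped with the supremum distance. Then the map Lip_L → ℝ given by γ ↦ ∫₀¹ g(γ(t)) · (f ∘ γ)′(t) dt is Borel measurable, where (f ∘ γ)′ denotes the derivative of the Lipschitz function f ∘ γ : [0,1] → ℝ (which exists Lebesgue-almost everywhere; any Borel total extension of it, e.g. Lean's deriv, may be used). -/
open MeasureTheory

/-- The integrand `g (γ t) · (f ∘ γ)′(t)` of a Lipschitz curve is approximated, after integration,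
by forward difference quotients. -/
theorem tendsto_integral_mul_forward_difference {G h : ℝ → ℝ} {M : ℝ} {K : NNReal}
    (hG : Continuous G) (hGM : ∀ t, |G t| ≤ M) (hh : LipschitzWith K h) (a b : ℝ) :
    Filter.Tendsto
      (fun n : ℕ => ∫ t in a..b, G t * (((n : ℝ) + 1) * (h (t + 1 / ((n : ℝ) + 1)) - h t)))
      Filter.atTop (nhds (∫ t in a..b, G t * deriv h t)) := by
  have hhc := hh.continuous
  refine intervalIntegral.tendsto_integral_filter_of_dominated_convergence (fun _ => M * K)
    (Filter.Eventually.of_forall fun n => ?_) (Filter.Eventually.of_forall fun n => ?_)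
    intervalIntegrable_const ?_
  · exact Continuous.aestronglyMeasurable (by fun_prop)
  · refine Filter.Eventually.of_forall fun t _ => ?_
    have hn : (0 : ℝ) < (n : ℝ) + 1 := by positivity
    have h1 := hh.dist_le_mul (t + 1 / ((n : ℝ) + 1)) t
    rw [Real.dist_eq, Real.dist_eq, add_sub_cancel_left, abs_of_pos (one_div_pos.2 hn)] at h1
    rw [norm_mul, Real.norm_eq_abs, Real.norm_eq_abs, abs_mul, abs_of_pos hn]
    refine mul_le_mul (hGM t) ?_ (by positivity) ((abs_nonneg _).trans (hGM t))
    calc ((n : ℝ) + 1) * |h (t + 1 / ((n : ℝ) + 1)) - h t|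
        ≤ ((n : ℝ) + 1) * (K * (1 / ((n : ℝ) + 1))) := by gcongr
      _ = K := by field_simp
  · filter_upwards [hh.ae_differentiableAt (μ := volume)] with t ht _
    refine Filter.Tendsto.const_mul _ ?_
    have hslope := hasDerivAt_iff_tendsto_slope_zero.1 ht.hasDerivAt
    have hstep : Filter.Tendsto (fun n : ℕ => 1 / ((n : ℝ) + 1)) Filter.atTop
        (nhdsWithin 0 {0}ᶜ) := by
      refine tendsto_nhdsWithin_iff.2 ⟨tendsto_one_div_add_atTop_nhds_zero_nat,
        Filter.Eventually.of_forall fun n => ?_⟩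
      have hn : (0 : ℝ) < 1 / ((n : ℝ) + 1) := by positivity
      exact hn.ne'
    refine (hslope.comp hstep).congr fun n => ?_
    simp

/-- On the set of `L`-Lipschitz curves in `C([0,1]; Y)` (with the
supremum distance), the map `γ ↦ ∫₀¹ g(γ t) · (f ∘ γ)′(t) dt` is Borel measurable,
where the a.e.-defined derivative of the Lipschitz function `f ∘ γ` is represented by
Lean's total Borel extension `deriv` (applied to the `c`onstant extension of `γ`
beyond `[0,1]`). -/
theorem current_action_borel_on_lipschitz_curves
    {Y : Type*} [MetricSpace Y] [TopologicalSpace.SeparableSpace Y] [CompleteSpace Y]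
    (L : ℝ) (hL : 0 < L)
    (g f : Y → ℝ)
    (hgbdd : ∃ M : ℝ, ∀ x : Y, |g x| ≤ M)
    (hg : ∃ Kg : NNReal, LipschitzWith Kg g)
    (hf : ∃ Kf : NNReal, LipschitzWith Kf f) :
    @Measurable {γ : C(Set.Icc (0:ℝ) 1, Y) // LipschitzWith (Real.toNNReal L) ⇑γ} ℝ
      (borel _) _
      (fun γ => ∫ t in (0:ℝ)..1,
        g ((γ : C(Set.Icc (0:ℝ) 1, Y)) (Set.projIcc 0 1 zero_le_one t)) *
          deriv (fun s : ℝ =>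
            f ((γ : C(Set.Icc (0:ℝ) 1, Y)) (Set.projIcc 0 1 zero_le_one s))) t) := by
  obtain ⟨M, hM⟩ := hgbdd
  obtain ⟨Kg, hKg⟩ := hg
  obtain ⟨Kf, hKf⟩ := hf
  have hgc := hKg.continuous
  have hfc := hKf.continuous
  borelize {γ : C(Set.Icc (0:ℝ) 1, Y) // LipschitzWith (Real.toNNReal L) ⇑γ}
  refine measurable_of_tendsto_metrizable
    (f := fun (n : ℕ) (γ : {γ : C(Set.Icc (0:ℝ) 1, Y) // LipschitzWith (Real.toNNReal L) ⇑γ}) =>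
      ∫ t in (0:ℝ)..1, g (γ.1 (Set.projIcc 0 1 zero_le_one t)) * (((n : ℝ) + 1) *
        (f (γ.1 (Set.projIcc 0 1 zero_le_one (t + 1 / ((n : ℝ) + 1)))) -
          f (γ.1 (Set.projIcc 0 1 zero_le_one t))))) (fun n => ?_)
    (tendsto_pi_nhds.2 fun γ => ?_)
  · refine Continuous.measurable ?_
    refine intervalIntegral.continuous_parametric_intervalIntegral_of_continuous' ?_ 0 1
    have hp : Continuous (Set.projIcc (0:ℝ) 1 zero_le_one) := continuous_projIcc
    unfold Function.uncurry
    fun_prop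
  · exact tendsto_integral_mul_forward_difference
      (hgc.comp (γ.1.continuous.comp continuous_projIcc)) (fun t => hM _)
      (hKf.comp (γ.2.comp (LipschitzWith.projIcc zero_le_one))) 0 1
end
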